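/- Let t ≥ 1 and k ≥ 1 be real numbers. Then for every r ∈ [0, 1/(2tk)], h_r(t, −k) ≥ e^{−1}, where h_r(t,s) = (1 − r²)^{−1/2} · exp( (r t s − ½(t² + s²) r²) / (1 − r²) ). -/

import Mathlib

/-- The kernel `h_r(t,s) = (1-r²)^{-1/2} exp((rts - ½(t²+s²)r²)/(1-r²))`. -/
noncomputable def hker (r t s : ℝ) : ℝ :=
  (1 / Real.sqrt (1 - r ^ 2)) *
    Real.exp ((r * t * s - (t ^ 2 + s ^ 2) / 2 * r ^ 2) / (1 - r ^ 2))

/-- For `t, k ≥ 1` and `0 ≤ r ≤ 1/(2tk)` one has `h_r(t, -k) ≥ e⁻¹`. -/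
theorem stmt9 (t k : ℝ) (ht : 1 ≤ t) (hk : 1 ≤ k) (r : ℝ)
    (hr0 : 0 ≤ r) (hr1 : r ≤ 1 / (2 * t * k)) :
    hker r t (-k) ≥ Real.exp (-1) := by
  have h0 : 0 < 2 * t * k := by positivity
  have h1 : r * (2 * t * k) ≤ 1 := (le_div_iff₀ h0).mp hr1
  have hrt0 : 0 ≤ r * t := by positivity
  have hrk0 : 0 ≤ r * k := by positivity
  have hrt : r * t ≤ 1 / 2 := by nlinarith
  have hrk : r * k ≤ 1 / 2 := by nlinarith
  have hr : r ≤ 1 / 2 := by nlinarith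
  have e1 : (r * t) ^ 2 ≤ 1 / 4 := by nlinarith
  have e2 : (r * k) ^ 2 ≤ 1 / 4 := by nlinarith
  have e3 : r ^ 2 ≤ 1 / 4 := by nlinarith
  have hpos : 0 < 1 - r ^ 2 := by linarith
  have hexp : -1 ≤ (r * t * (-k) - (t ^ 2 + (-k) ^ 2) / 2 * r ^ 2) / (1 - r ^ 2) := by
    rw [le_div_iff₀ hpos]
    nlinarith
  have hs0 : 0 < Real.sqrt (1 - r ^ 2) := Real.sqrt_pos.mpr hpos
  have hs1 : Real.sqrt (1 - r ^ 2) ≤ 1 := Real.sqrt_le_one.mpr (by nlinarith [sq_nonneg r])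
  have hA : 1 ≤ 1 / Real.sqrt (1 - r ^ 2) := by
    rw [le_div_iff₀ hs0]
    linarith
  have hE := Real.exp_le_exp.mpr hexp
  unfold hker
  exact hE.trans (le_mul_of_one_le_left (Real.exp_pos _).le hA)
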